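/- Let A be a minimal WFA realizing a rational function f : Σ* → ℝ. The reachability Gramian G_p = P_AᵀP_A and the observability Gramian G_s = S_AᵀS_A are both well-defined (all the defining sums over Σ* converge) if and only if f ∈ ℓ²(Σ), i.e. Σ_{x∈Σ*} f(x)² < ∞. -/

import Mathlib

open scoped ENNReal
open scoped Kronecker
open Matrix

noncomputable section

/-- A weighted finite automaton of dimension `n` over alphabet `S`,
with initial weights, final weights and transition matrices. -/
structure WFA (S : Type*) (n : ℕ) where
  init : Fin n → ℝ
  final : Fin n → ℝ
  trans : S → Matrix (Fin n) (Fin n) ℝ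

namespace WFA

variable {S : Type*} {n : ℕ}

/-- `A_x = A_{x₁} ⋯ A_{x_t}` (identity for the empty string). -/
def matOf (M : WFA S n) (x : List S) : Matrix (Fin n) (Fin n) ℝ :=
  (x.map M.trans).prod

/-- The function computed by the WFA: `f_A(x) = αᵀ A_x β`. -/
def f (M : WFA S n) (x : List S) : ℝ :=
  M.init ⬝ᵥ (M.matOf x).mulVec M.final

/-- Row `p` of the forward matrix: `αᵀ A_p`. -/
def fwd (M : WFA S n) (x : List S) : Fin n → ℝ :=
  Matrix.vecMul M.init (M.matOf x)

/-- Row `s` of the backward matrix: `(A_s β)ᵀ`. -/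
def bwd (M : WFA S n) (x : List S) : Fin n → ℝ :=
  (M.matOf x).mulVec M.final

/-- `M` is a minimal WFA: no WFA of strictly smaller dimension computes the same function. -/
def Min (M : WFA S n) : Prop :=
  ∀ m : ℕ, (∃ B : WFA S m, B.f = M.f) → n ≤ m

/-- The reachability Gramian `G_p = Pᵀ P` is well-defined: all its defining sums converge. -/
def GpDefined (M : WFA S n) : Prop :=
  ∀ i j, Summable fun x : List S => M.fwd x i * M.fwd x j

/-- The observability Gramian `G_s = Sᵀ S` is well-defined: all its defining sums converge. -/
def GsDefined (M : WFA S n) : Prop :=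
  ∀ i j, Summable fun x : List S => M.bwd x i * M.bwd x j

/-- The reachability Gramian `G_p = Pᵀ P`. -/
def Gp (M : WFA S n) : Matrix (Fin n) (Fin n) ℝ :=
  Matrix.of fun i j => ∑' x : List S, M.fwd x i * M.fwd x j

/-- The observability Gramian `G_s = Sᵀ S`. -/
def Gs (M : WFA S n) : Matrix (Fin n) (Fin n) ℝ :=
  Matrix.of fun i j => ∑' x : List S, M.bwd x i * M.bwd x j

/-- Truncation of a WFA to its first `m` states. -/
def trunc (M : WFA S n) (m : ℕ) (h : m ≤ n) : WFA S m where
  init := fun i => M.init (Fin.castLE h i)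
  final := fun i => M.final (Fin.castLE h i)
  trans := fun a => Matrix.of fun i j => M.trans a (Fin.castLE h i) (Fin.castLE h j)

end WFA

/-- A function `f : Σ* → ℝ` is rational if it is computed by some WFA. -/
def IsRational {S : Type*} (f : List S → ℝ) : Prop :=
  ∃ (n : ℕ) (M : WFA S n), M.f = f

/-- Spectral radius of a real square matrix: the largest modulus of its complex eigenvalues. -/
def specRad {d : Type*} [Fintype d] [DecidableEq d] (M : Matrix d d ℝ) : ℝ≥0∞ :=
  spectralRadius ℂ (M.map (algebraMap ℝ ℂ))

/-- Induced ∞-norm of a matrix: maximum absolute row sum. -/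
def normInfM {d e : Type*} [Fintype d] [Fintype e] (M : Matrix d e ℝ) : ℝ :=
  ⨆ i, ∑ j, |M i j|

/-- Induced 1-norm of a matrix: maximum absolute column sum. -/
def normOneM {d e : Type*} [Fintype d] [Fintype e] (M : Matrix d e ℝ) : ℝ :=
  ⨆ j, ∑ i, |M i j|

/-- The `p`-norm of a finite-dimensional real vector, `1 ≤ p ≤ ∞`. -/
def vecPNorm {d : Type*} [Fintype d] (p : ℝ≥0∞) (v : d → ℝ) : ℝ :=
  if p = ⊤ then ⨆ i, |v i| else (∑ i, |v i| ^ p.toReal) ^ (1 / p.toReal)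

/-- The induced matrix `p`-norm `‖M‖_p = sup_{‖v‖_p = 1} ‖Mv‖_p`. -/
def inducedPNorm {d : Type*} [Fintype d] (p : ℝ≥0∞) (M : Matrix d d ℝ) : ℝ :=
  sSup {r | ∃ v : d → ℝ, vecPNorm p v = 1 ∧ r = vecPNorm p (M.mulVec v)}

/-- The operator norm of the Hankel operator of `f` on `ℓ²`. -/
def hankelOpNorm {S : Type*} (f : List S → ℝ) : ℝ :=
  sSup {r | ∃ g : List S → ℝ, (Summable fun y => g y ^ 2) ∧ (∑' y, g y ^ 2) ≤ 1 ∧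
    (Summable fun x : List S => (∑' y : List S, f (x ++ y) * g y) ^ 2) ∧
    r = Real.sqrt (∑' x : List S, (∑' y : List S, f (x ++ y) * g y) ^ 2)}

end

namespace WFA

variable {S : Type*} {n : ℕ}

theorem matOf_cons (M : WFA S n) (a : S) (x : List S) :
    M.matOf (a :: x) = M.trans a * M.matOf x := by
  simp [matOf]

theorem matOf_append (M : WFA S n) (x y : List S) :
    M.matOf (x ++ y) = M.matOf x * M.matOf y := by
  simp [matOf]

theorem f_append (M : WFA S n) (x y : List S) :
    M.f (x ++ y) = M.fwd x ⬝ᵥ M.bwd y := by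
  rw [f, fwd, bwd, matOf_append, ← Matrix.mulVec_mulVec, Matrix.dotProduct_mulVec]

theorem bwd_cons (M : WFA S n) (a : S) (x : List S) :
    M.bwd (a :: x) = (M.trans a).mulVec (M.bwd x) := by
  rw [bwd, bwd, matOf_cons, Matrix.mulVec_mulVec]

/-- The automaton with initial and final weights swapped and transition matrices transposed;
it computes the reversed function. -/
def reversed (M : WFA S n) : WFA S n where
  init := M.final
  final := M.init
  trans := fun a => (M.trans a)ᵀ

theorem matOf_reversed (M : WFA S n) (x : List S) :
    M.reversed.matOf x = (M.matOf x.reverse)ᵀ := by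
  simp [matOf, reversed, Matrix.transpose_list_prod, Function.comp_def]

theorem fwd_reversed (M : WFA S n) (x : List S) : M.reversed.fwd x = M.bwd x.reverse := by
  rw [fwd, matOf_reversed, Matrix.vecMul_transpose]
  rfl

theorem f_reversed (M : WFA S n) (x : List S) : M.reversed.f x = M.f x.reverse := by
  rw [f, f, matOf_reversed, Matrix.mulVec_transpose, dotProduct_comm,
    Matrix.dotProduct_mulVec]
  rfl

theorem Min.reversed {M : WFA S n} (h : M.Min) : M.reversed.Min := by
  rintro m ⟨B, hB⟩
  refine h m ⟨B.reversed, funext fun x => ?_⟩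
  rw [f_reversed, hB, f_reversed, List.reverse_reverse]

/-- An automaton intertwined with `M` by a matrix `P` computes the same function. -/
theorem f_eq_of_intertwine {m : ℕ} (M : WFA S n) (B : WFA S m) (P : Matrix (Fin n) (Fin m) ℝ)
    (hi : B.init = Matrix.vecMul M.init P) (hf : P.mulVec B.final = M.final)
    (ht : ∀ a, M.trans a * P = P * B.trans a) : B.f = M.f := by
  have hx (x : List S) : M.matOf x * P = P * B.matOf x := by
    induction x with
    | nil => simp [matOf]
    | cons a x ih =>
      rw [matOf_cons, matOf_cons, Matrix.mul_assoc, ih, ← Matrix.mul_assoc, ht, Matrix.mul_assoc]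
  funext x
  rw [f, f, hi, ← hf, Matrix.mulVec_mulVec, hx, ← Matrix.mulVec_mulVec, Matrix.dotProduct_mulVec,
    Matrix.dotProduct_mulVec, Matrix.dotProduct_mulVec, Matrix.vecMul_vecMul]

/-- The backward vectors of a minimal automaton span the state space. -/
theorem Min.span_bwd {M : WFA S n} (h : M.Min) :
    Submodule.span ℝ (Set.range M.bwd) = ⊤ := by
  set V := Submodule.span ℝ (Set.range M.bwd)
  have hinv (a : S) (v : Fin n → ℝ) (hv : v ∈ V) : (M.trans a).mulVec v ∈ V := by
    have hle : V ≤ V.comap (M.trans a).mulVecLin := by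
      refine Submodule.span_le.2 ?_
      rintro _ ⟨x, rfl⟩
      exact Submodule.subset_span ⟨a :: x, bwd_cons M a x⟩
    exact hle hv
  let b := Module.finBasis ℝ V
  let P : Matrix (Fin n) (Fin (Module.finrank ℝ V)) ℝ := Matrix.of fun i j => (b j : Fin n → ℝ) i
  have hP (v : Fin n → ℝ) (hv : v ∈ V) : ∃ w, P.mulVec w = v := by
    refine ⟨b.repr ⟨v, hv⟩, ?_⟩
    have hsum := congrArg (Subtype.val : V → Fin n → ℝ) (b.sum_repr ⟨v, hv⟩)
    ext i
    refine Eq.trans ?_ (congrFun hsum i)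
    simp [-Module.Basis.sum_repr, P, Matrix.mulVec, dotProduct, mul_comm]
  obtain ⟨w, hw⟩ := hP M.final (Submodule.subset_span ⟨[], by simp [bwd, matOf]⟩)
  choose T hT using fun a j => hP _ (hinv a (b j) (b j).2)
  have hle := h _ ⟨⟨Matrix.vecMul M.init P, w, fun a => Matrix.of fun i j => T a j i⟩,
    f_eq_of_intertwine M _ P rfl hw fun a => by
      ext i j
      exact (congrFun (hT a j) i).symm⟩
  refine Submodule.eq_top_of_finrank_eq (le_antisymm (Submodule.finrank_le V) ?_)
  simpa using hle

/-- If the pairings of a family with a spanning set are square-summable, then so are all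
products of its coordinates. -/
theorem summable_mul_of_span_eq_top {ι : Type*} (u : ι → Fin n → ℝ) (s : Set (Fin n → ℝ))
    (hs : Submodule.span ℝ s = ⊤) (h : ∀ v ∈ s, Summable fun x => (u x ⬝ᵥ v) ^ 2)
    (i j : Fin n) : Summable fun x => u x i * u x j := by
  have hall (v : Fin n → ℝ) : Summable fun x => (u x ⬝ᵥ v) ^ 2 := by
    have hv : v ∈ Submodule.span ℝ s := hs ▸ Submodule.mem_top
    induction hv using Submodule.span_induction with
    | mem v hv => exact h v hv
    | zero => simp
    | add v w _ _ hv hw =>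
      refine Summable.of_nonneg_of_le (fun x => sq_nonneg _) (fun x => ?_)
        ((hv.add hw).mul_left 2)
      rw [dotProduct_add]
      exact add_sq_le
    | smul c v _ hv => simpa [dotProduct_smul, mul_pow] using hv.mul_left (c ^ 2)
  have hcoord (k : Fin n) : Summable fun x => u x k ^ 2 := by
    simpa using hall (Pi.single k 1)
  refine Summable.of_norm_bounded ((hcoord i).add (hcoord j)) fun x => ?_
  rw [Real.norm_eq_abs, abs_le]
  constructor <;> nlinarith [sq_nonneg (u x i + u x j), sq_nonneg (u x i - u x j)]

theorem Min.gpDefined {M : WFA S n} (h : M.Min) (hf : Summable fun x => M.f x ^ 2) :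
    M.GpDefined := by
  refine summable_mul_of_span_eq_top M.fwd _ h.span_bwd ?_
  rintro _ ⟨y, rfl⟩
  simpa only [Function.comp_def, f_append] using
    hf.comp_injective (List.append_left_injective y)

theorem gsDefined_of_gpDefined_reversed {M : WFA S n} (h : M.reversed.GpDefined) :
    M.GsDefined := fun i j => by
  simpa only [Function.comp_def, fwd_reversed, List.reverse_reverse] using
    (h i j).comp_injective List.reverse_injective

theorem GsDefined.summable_sq {M : WFA S n} (h : M.GsDefined) :
    Summable fun x => M.f x ^ 2 := by
  have hsum : Summable fun x => ∑ i, ∑ j, M.init i * M.init j * (M.bwd x i * M.bwd x j) :=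
    summable_sum fun i _ => summable_sum fun j _ => (h i j).mul_left _
  refine hsum.congr fun x => ?_
  symm
  change (M.init ⬝ᵥ M.bwd x) ^ 2 = _
  rw [dotProduct, sq, Finset.sum_mul_sum]
  exact Finset.sum_congr rfl fun i _ => Finset.sum_congr rfl fun j _ => by ring

end WFA

/-- for a minimal WFA realizing `f`, both Gramians are well-defined iff
`f ∈ ℓ²`. -/
theorem gramians_defined_iff_ell_two {S : Type*} [Fintype S] {n : ℕ} (M : WFA S n)
    (f : List S → ℝ) (hf : M.f = f) (hmin : M.Min) :
    (M.GpDefined ∧ M.GsDefined) ↔ Summable fun x : List S => f x ^ 2 := by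
  subst hf
  refine ⟨fun h => h.2.summable_sq, fun h => ⟨hmin.gpDefined h,
    WFA.gsDefined_of_gpDefined_reversed (hmin.reversed.gpDefined ?_)⟩⟩
  simpa only [Function.comp_def, WFA.f_reversed] using
    h.comp_injective List.reverse_injective
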